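/- arXiv:1511.03139 — 4 statements merged into one kernel-verified Lean document; each statement's English description precedes it below -/
import Mathlib

section
/- Let n ≥ 2, let σ be a permutation of {1,…,n−1}, and let σ′ be the permutation of {1,…,n} defined by σ′(x) = σ(x) for 1 ≤ x ≤ n−1 and σ′(n) = n. Then F_{σ′}(z) = (n−1)·F_σ(z) as polynomials. -/
open Finset Polynomial

/-- Number of cycles of a permutation, counting fixed points as cycles of length 1
(equivalently, the number of orbits). -/
noncomputable def cycleCount {α : Type*} [Fintype α] [DecidableEq α] (σ : Equiv.Perm α) : ℕ :=
  σ.cycleType.card + (Finset.univ.filter fun x => σ x = x).card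

/-- The IO-polynomial `F_π(z) = Σ_{ζ ∈ Q_n} z^⌊(c(ζπ)-1)/2⌋`, where `Q_n` is the set of
`n`-cycles of `S_n` (i.e. permutations with a single cycle), and `ζπ` applies `ζ` first
and then `π`. -/
noncomputable def IOPoly {n : ℕ} (π : Equiv.Perm (Fin n)) : Polynomial ℝ :=
  ∑ ζ ∈ Finset.univ.filter (fun ζ : Equiv.Perm (Fin n) => cycleCount ζ = 1),
    Polynomial.X ^ ((cycleCount (π * ζ) - 1) / 2)

open Equiv Equiv.Perm

section CycleCount

variable {α β : Type*}

/-- A map sending each step of `σ` inside a cycle of `τ` sends cycles of `σ` into cycles of `τ`. -/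
theorem sameCycle_map {σ : Perm α} {τ : Perm β} (f : α → β)
    (hf : ∀ x, SameCycle τ (f x) (f (σ x))) {x y : α} (h : SameCycle σ x y) :
    SameCycle τ (f x) (f y) := by
  obtain ⟨i, rfl⟩ := h
  induction i with
  | zero => exact SameCycle.refl _ _
  | succ i ih =>
    rw [add_comm, zpow_add, zpow_one, Perm.mul_apply]
    exact ih.trans (hf _)
  | pred i ih =>
    have h := hf ((σ ^ (-(i : ℤ) - 1)) x)
    rw [← Perm.mul_apply, ← zpow_one_add, add_sub_cancel] at h
    exact ih.trans h.symm

theorem optionCongr_mul_swap_none_some_mul [DecidableEq α] (σ τ : Perm α) (a : α) :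
    (σ.optionCongr * (swap none (some a) * τ.optionCongr) : Perm (Option α)) =
      swap none (some (σ a)) * (σ * τ).optionCongr := by
  rw [← mul_assoc, mul_swap_eq_swap_mul, mul_assoc]
  simp [Equiv.Perm.mul_def]

variable [Fintype α] [DecidableEq α] [Fintype β] [DecidableEq β]

theorem cycleCount_eq_card_quotient (σ : Perm α) :
    cycleCount σ = Nat.card (Quotient (SameCycle.setoid σ)) := by
  let F : α → σ.cycleFactorsFinset ⊕ {x // σ x = x} := fun x =>
    if h : σ x = x then .inr ⟨x, h⟩
    else .inl ⟨cycleOf σ x, cycleOf_mem_cycleFactorsFinset_iff.2 (mem_support.2 h)⟩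
  have hF : Function.Surjective F := by
    rintro (⟨c, hc⟩ | ⟨x, hx⟩)
    · obtain ⟨x, hx⟩ := (mem_cycleFactorsFinset_iff.1 hc).1.nonempty_support
      have hσ : σ x ≠ x := mem_support.1 (mem_cycleFactorsFinset_support_le hc hx)
      exact ⟨x, by simp [F, hσ, cycle_is_cycleOf hx hc]⟩
    · exact ⟨x, by simp [F, hx]⟩
  have hker : SameCycle.setoid σ = Setoid.ker F := by
    ext x y
    change SameCycle σ x y ↔ F x = F y
    by_cases hx : σ x = x
    · have : SameCycle σ x y ↔ x = y :=
        ⟨fun h => h.eq_of_left hx, fun h => h ▸ SameCycle.refl _ _⟩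
      by_cases hy : σ y = y
      · simp [F, hx, hy, this]
      · simp only [F, hx, hy, this, dite_true, dite_false, reduceCtorEq, iff_false]
        rintro rfl
        exact hy hx
    · by_cases hy : σ y = y
      · simp only [F, hx, hy, dite_true, dite_false, reduceCtorEq, iff_false]
        intro h
        exact hx (h.apply_eq_self_iff.2 hy)
      · simp only [F, hx, hy, dite_false, Sum.inl.injEq, Subtype.mk.injEq]
        exact sameCycle_iff_cycleOf_eq_of_mem_support (mem_support.2 hx) (mem_support.2 hy)
  rw [hker, Nat.card_congr (Setoid.quotientKerEquivOfSurjective F hF), Nat.card_sum,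
    Nat.card_eq_fintype_card, Nat.card_eq_fintype_card, Fintype.card_coe, Fintype.card_subtype,
    cycleCount, cycleType_def, Multiset.card_map, Finset.card_val]

theorem cycleCount_eq_of_maps {σ : Perm α} {τ : Perm β} (f : α → β) (g : β → α)
    (hf : ∀ x, SameCycle τ (f x) (f (σ x))) (hg : ∀ y, SameCycle σ (g y) (g (τ y)))
    (hgf : ∀ x, SameCycle σ (g (f x)) x) (hfg : ∀ y, SameCycle τ (f (g y)) y) :
    cycleCount σ = cycleCount τ := by
  rw [cycleCount_eq_card_quotient, cycleCount_eq_card_quotient]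
  exact Nat.card_congr
    { toFun := Quotient.map f fun _ _ h => sameCycle_map f hf h
      invFun := Quotient.map g fun _ _ h => sameCycle_map g hg h
      left_inv := fun q => Quotient.inductionOn q fun x => Quotient.sound (hgf x)
      right_inv := fun q => Quotient.inductionOn q fun y => Quotient.sound (hfg y) }

theorem cycleCount_permCongr (e : α ≃ β) (σ : Perm α) :
    cycleCount (e.permCongr σ) = cycleCount σ := by
  refine cycleCount_eq_of_maps e.symm e (fun x => ?_) (fun y => ?_) (fun x => ?_) (fun y => ?_)
  · simp [Equiv.permCongr_apply, SameCycle.refl]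
  · simpa [Equiv.permCongr_apply] using
      (sameCycle_apply_right (f := e.permCongr σ)).2 (SameCycle.refl _ (e y))
  · simp [SameCycle.refl]
  · simp [SameCycle.refl]

/-- Inserting a new letter into an existing cycle does not change the number of cycles. -/
theorem cycleCount_swap_none_some_mul (a : α) (τ : Perm α) :
    cycleCount (swap none (some a) * τ.optionCongr) = cycleCount τ := by
  set π : Perm (Option α) := swap none (some a) * τ.optionCongr with hπ
  have hnone : π none = some a := by simp [hπ]
  have hsome (x : α) : π (some x) = if τ x = a then none else some (τ x) := by
    simp [hπ, swap_apply_def]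
  have hna : SameCycle π none (some a) := hnone ▸ sameCycle_apply_right.2 (SameCycle.refl _ _)
  have hstep (x : α) : SameCycle π (some x) (some (τ x)) := by
    have h : SameCycle π (some x) (π (some x)) := sameCycle_apply_right.2 (SameCycle.refl _ _)
    rw [hsome] at h
    split_ifs at h with hx
    · exact hx ▸ h.trans hna
    · exact h
  refine cycleCount_eq_of_maps (fun p => p.getD a) some (fun p => ?_) hstep (fun p => ?_)
    (fun x => SameCycle.refl _ _)
  · cases p with
    | none => simp [hnone, SameCycle.refl]
    | some x =>
      rw [hsome]
      split_ifs with hx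
      · simpa [hx] using (sameCycle_apply_right (f := τ)).2 (SameCycle.refl τ x)
      · simpa using (sameCycle_apply_right (f := τ)).2 (SameCycle.refl τ x)
  · cases p with
    | none => exact hna.symm
    | some x => exact SameCycle.refl _ _

theorem cycleCount_optionCongr_ne_one [Nonempty α] (τ : Perm α) :
    cycleCount (τ.optionCongr : Perm (Option α)) ≠ 1 := by
  intro h
  rw [cycleCount_eq_card_quotient, Nat.card_eq_one_iff_unique] at h
  obtain ⟨a⟩ := ‹Nonempty α›
  have hs : SameCycle (τ.optionCongr : Perm (Option α)) none (some a) :=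
    Quotient.exact (h.1.elim (Quotient.mk (SameCycle.setoid τ.optionCongr) none)
      (Quotient.mk (SameCycle.setoid τ.optionCongr) (some a)))
  exact Option.some_ne_none a (hs.eq_of_left (by simp [Function.IsFixedPt])).symm

/-- Summing over full cycles of `Option α` reduces to summing over full cycles of `α`. -/
theorem sum_full_cycles_optionCongr_mul {M : Type*} [AddCommMonoid M] [Nonempty α] (g : ℕ → M)
    (σ : Perm α) :
    ∑ ζ : Perm (Option α) with cycleCount ζ = 1, g (cycleCount (σ.optionCongr * ζ)) =
      Fintype.card α • ∑ ζ : Perm α with cycleCount ζ = 1, g (cycleCount (σ * ζ)) := by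
  rw [Finset.sum_filter, ← decomposeOption.symm.sum_comp, Fintype.sum_prod_type,
    Fintype.sum_option]
  simp only [decomposeOption_symm_apply, optionCongr_mul_swap_none_some_mul,
    cycleCount_swap_none_some_mul, swap_self, ← Equiv.Perm.one_def, one_mul,
    cycleCount_optionCongr_ne_one, if_false, Finset.sum_const_zero, zero_add,
    Finset.sum_const, Finset.card_univ, Finset.sum_filter]

end CycleCount

/-- If `σ'` is obtained from `σ ∈ S_{n-1}` by adding the letter `n` as a fixed point,
then `F_{σ'}(z) = (n-1)·F_σ(z)`. -/
theorem stmt_0 (n : ℕ) (hn : 2 ≤ n)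
    (σ : Equiv.Perm (Fin (n - 1))) (σ' : Equiv.Perm (Fin n))
    (hext : ∀ x : Fin (n - 1),
      σ' (Fin.castLE (Nat.sub_le n 1) x) = Fin.castLE (Nat.sub_le n 1) (σ x))
    (hfix : σ' ⟨n - 1, by omega⟩ = ⟨n - 1, by omega⟩) :
    IOPoly σ' = (n - 1 : ℕ) • IOPoly σ := by
  obtain ⟨m, rfl⟩ : ∃ m, n = m + 1 := ⟨n - 1, by omega⟩
  have : NeZero m := ⟨by omega⟩
  let e := finSuccEquivLast (n := m)
  have hσ : e.permCongr σ' = Equiv.optionCongr σ := by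
    ext1 p
    cases p with
    | none =>
      have : σ' (Fin.last m) = Fin.last m := hfix
      simp [e, Equiv.permCongr_apply, this]
    | some x =>
      have : σ' x.castSucc = (σ x).castSucc := hext x
      simp [e, Equiv.permCongr_apply, this]
  have key := sum_full_cycles_optionCongr_mul
    (fun k => (Polynomial.X : Polynomial ℝ) ^ ((k - 1) / 2)) (α := Fin m) σ
  rw [Fintype.card_fin, ← hσ, Finset.sum_filter, ← e.permCongr.sum_comp] at key
  simp only [← Equiv.permCongr_mul, cycleCount_permCongr] at key
  rw [← Finset.sum_filter] at key
  exact key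
end

section
/- Let n ≥ 2, let σ be a permutation of {1,…,n−1}, let σ′ be the permutation of {1,…,n} with σ′(x) = σ(x) for x ≤ n−1 and σ′(n) = n, let ζ be an (n−1)-cycle in S_{n−1}, fix a ∈ {1,…,n−1}, and let ζ′ be the permutation of {1,…,n} defined by ζ′(a) = n, ζ′(n) = ζ(a), and ζ′(x) = ζ(x) for all x ∉ {a, n}. Then ζ′ is an n-cycle in S_n, and the permutation x ↦ σ′(ζ′(x)) of {1,…,n} has exactly the same number of cycles as the permutation x ↦ σ(ζ(x)) of {1,…,n−1}, where fixed points count as cycles of length 1. -/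
open Finset Polynomial

open Equiv.Perm in
theorem cycleCount_eq_card_quotient_s2 {α : Type*} [Fintype α] [DecidableEq α]
    (f : Equiv.Perm α) : cycleCount f = Nat.card (Quotient (SameCycle.setoid f)) := by
  have hrep : ∀ c : f.cycleFactorsFinset, ∃ x, f x ≠ x ∧ f.cycleOf x = c := by
    rintro ⟨c, hc⟩
    obtain ⟨x, hx⟩ := (mem_cycleFactorsFinset_iff.1 hc).1.nonempty_support
    exact ⟨x, mem_support.1 (mem_cycleFactorsFinset_support_le hc hx),
      (cycle_is_cycleOf hx hc).symm⟩
  choose r hr hrc using hrep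
  let F : f.cycleFactorsFinset ⊕ {x // f x = x} → Quotient (SameCycle.setoid f) :=
    Sum.elim (fun c => ⟦r c⟧) (fun x => ⟦x.1⟧)
  have hF : Function.Bijective F := by
    constructor
    · rintro (c | x) (d | y) h
      · have h' : f.SameCycle (r c) (r d) := Quotient.exact h
        exact congrArg Sum.inl (Subtype.ext ((hrc c).symm.trans (h'.cycleOf_eq.trans (hrc d))))
      · have h' : f.SameCycle (r c) y := Quotient.exact h
        exact (hr c (h'.apply_eq_self_iff.2 y.2)).elim
      · have h' : f.SameCycle x (r d) := Quotient.exact h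
        exact (hr d (h'.apply_eq_self_iff.1 x.2)).elim
      · have h' : f.SameCycle x y := Quotient.exact h
        exact congrArg Sum.inr (Subtype.ext (h'.eq_of_left x.2))
    · intro q
      induction q using Quotient.inductionOn with
      | h x =>
        by_cases hx : f x = x
        · exact ⟨Sum.inr ⟨x, hx⟩, rfl⟩
        · have hc := cycleOf_mem_cycleFactorsFinset_iff.2 (mem_support.2 hx)
          exact ⟨Sum.inl ⟨_, hc⟩, Quotient.sound
            ((sameCycle_iff_cycleOf_eq_of_mem_support (mem_support.2 (hr _))
              (mem_support.2 hx)).2 (hrc ⟨_, hc⟩))⟩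
  rw [← Nat.card_congr (Equiv.ofBijective F hF), Nat.card_sum, cycleCount, cycleType_def]
  simp [Nat.card_eq_fintype_card, Fintype.card_subtype]

theorem Equiv.Perm.SameCycle.map {α β : Type*} [Finite α] {f : Equiv.Perm α} {g : Equiv.Perm β}
    {i : α → β} (hi : ∀ x, g.SameCycle (i x) (i (f x))) {x y : α} (h : f.SameCycle x y) :
    g.SameCycle (i x) (i y) := by
  obtain ⟨k, rfl⟩ := h.exists_nat_pow_eq
  clear h
  induction k with
  | zero => exact .rfl
  | succ k ih =>
    rw [pow_succ', Equiv.Perm.mul_apply]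
    exact ih.trans (hi _)

/-- Inserting a new point `b` right after `a` in a cycle of `f` preserves the number of cycles. -/
theorem cycleCount_eq_of_insert {α β : Type*} [Fintype α] [DecidableEq α] [Fintype β]
    [DecidableEq β] {f : Equiv.Perm α} {g : Equiv.Perm β} {i : α → β} {r : β → α} {a : α} {b : β}
    (hri : ∀ x, r (i x) = x) (hrb : r b = a) (hcover : ∀ z, z = b ∨ ∃ x, z = i x)
    (hga : g (i a) = b) (hgb : g b = i (f a)) (hg : ∀ x, x ≠ a → g (i x) = i (f x)) :
    cycleCount g = cycleCount f := by
  have hab : g.SameCycle (i a) b := ⟨1, by simpa using hga⟩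
  have hi : ∀ x, g.SameCycle (i x) (i (f x)) := by
    intro x
    by_cases hx : x = a
    · subst hx
      exact hab.trans ⟨1, by simpa using hgb⟩
    · exact ⟨1, by simpa using hg x hx⟩
  have hr : ∀ z, f.SameCycle (r z) (r (g z)) := by
    intro z
    obtain rfl | ⟨x, rfl⟩ := hcover z
    · exact ⟨1, by simp [hgb, hri, hrb]⟩
    · by_cases hx : x = a
      · subst hx
        rw [hga, hrb, hri]
      · exact ⟨1, by simp [hg x hx, hri]⟩
  rw [cycleCount_eq_card_quotient_s2, cycleCount_eq_card_quotient_s2]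
  refine Nat.card_congr ⟨Quotient.map r fun _ _ h => .map hr h,
    Quotient.map i fun _ _ h => .map hi h, ?_, ?_⟩
  · intro q
    induction q using Quotient.inductionOn with
    | h z =>
      refine Quotient.sound ?_
      change g.SameCycle (i (r z)) z
      obtain rfl | ⟨x, rfl⟩ := hcover z
      · rwa [hrb]
      · rw [hri]
  · intro q
    induction q using Quotient.inductionOn with
    | h x => exact congrArg _ (hri x)

/-- Inserting the letter `n` right after the letter `a` in an `(n-1)`-cycle `ζ` gives an
`n`-cycle `ζ'`, and if `σ'` extends `σ ∈ S_{n-1}` by the fixed point `n`, then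
`x ↦ σ'(ζ'(x))` has exactly as many cycles as `x ↦ σ(ζ(x))`. -/
theorem stmt_2 (n : ℕ) (hn : 2 ≤ n)
    (σ : Equiv.Perm (Fin (n - 1))) (σ' : Equiv.Perm (Fin n))
    (hσext : ∀ x : Fin (n - 1),
      σ' (Fin.castLE (Nat.sub_le n 1) x) = Fin.castLE (Nat.sub_le n 1) (σ x))
    (hσfix : σ' ⟨n - 1, by omega⟩ = ⟨n - 1, by omega⟩)
    (ζ : Equiv.Perm (Fin (n - 1))) (hζ : cycleCount ζ = 1)
    (a : Fin (n - 1)) (ζ' : Equiv.Perm (Fin n))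
    (hζ'a : ζ' (Fin.castLE (Nat.sub_le n 1) a) = ⟨n - 1, by omega⟩)
    (hζ'n : ζ' ⟨n - 1, by omega⟩ = Fin.castLE (Nat.sub_le n 1) (ζ a))
    (hζ'x : ∀ x : Fin (n - 1), x ≠ a →
      ζ' (Fin.castLE (Nat.sub_le n 1) x) = Fin.castLE (Nat.sub_le n 1) (ζ x)) :
    cycleCount ζ' = 1 ∧ cycleCount (σ' * ζ') = cycleCount (σ * ζ) := by
  have insert : ∀ (f : Equiv.Perm (Fin (n - 1))) (g : Equiv.Perm (Fin n)),
      g (Fin.castLE (Nat.sub_le n 1) a) = ⟨n - 1, by omega⟩ →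
      g ⟨n - 1, by omega⟩ = Fin.castLE (Nat.sub_le n 1) (f a) →
      (∀ x : Fin (n - 1), x ≠ a →
        g (Fin.castLE (Nat.sub_le n 1) x) = Fin.castLE (Nat.sub_le n 1) (f x)) →
      cycleCount g = cycleCount f := by
    intro f g
    refine cycleCount_eq_of_insert (r := fun z => if h : z.1 < n - 1 then ⟨z.1, h⟩ else a)
      (fun x => by simp) (by simp) fun z => ?_
    by_cases h : z.1 < n - 1
    · exact Or.inr ⟨⟨z.1, h⟩, rfl⟩
    · exact Or.inl (Fin.ext (by change z.1 = n - 1; omega))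
  refine ⟨(insert ζ ζ' hζ'a hζ'n hζ'x).trans hζ, insert _ _ ?_ ?_ fun x hx => ?_⟩
  · rw [Equiv.Perm.mul_apply, hζ'a, hσfix]
  · rw [Equiv.Perm.mul_apply, hζ'n, hσext, Equiv.Perm.mul_apply]
  · rw [Equiv.Perm.mul_apply, hζ'x x hx, hσext, Equiv.Perm.mul_apply]
end

section
/- Let n ≥ 1 and π ∈ S_n. Then the polynomials G_π and F_π satisfy the identity G_π(z) = z^{p(π)+1} · F_π(z²). -/
open Finset Polynomial

/-- The polynomial `G_π(z) = Σ_{ζ ∈ Q_n} z^{c(ζπ)}`. -/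
noncomputable def GPoly {n : ℕ} (π : Equiv.Perm (Fin n)) : Polynomial ℝ :=
  ∑ ζ ∈ Finset.univ.filter (fun ζ : Equiv.Perm (Fin n) => cycleCount ζ = 1),
    Polynomial.X ^ (cycleCount (π * ζ))

theorem sign_eq_neg_one_pow_card_add_cycleCount {α : Type*} [Fintype α] [DecidableEq α]
    (σ : Equiv.Perm α) :
    Equiv.Perm.sign σ = (-1) ^ (Fintype.card α + cycleCount σ) := by
  have hfix : σ.support.card + (Finset.univ.filter fun x => σ x = x).card = Fintype.card α := by
    have h := Finset.card_filter_add_card_filter_not (s := (Finset.univ : Finset α))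
      (fun x => σ x = x)
    rw [Finset.card_univ] at h
    rw [← h, add_comm]
    rfl
  rw [Equiv.Perm.sign_of_cycleType, Equiv.Perm.sum_cycleType, cycleCount, ← hfix]
  set f := (Finset.univ.filter fun x => σ x = x).card
  have h : σ.support.card + f + (σ.cycleType.card + f) =
      σ.support.card + σ.cycleType.card + 2 * f := by ring
  rw [h, pow_add _ _ (2 * f), pow_mul]
  simp

theorem cycleCount_pos {α : Type*} [Fintype α] [DecidableEq α] [Nonempty α]
    (σ : Equiv.Perm α) : 0 < cycleCount σ := by
  by_cases h : σ = 1
  · subst h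
    simp [cycleCount, Fintype.card_pos]
  · have := Equiv.Perm.card_cycleType_pos.2 h
    unfold cycleCount
    omega

/-- If `ζ` is a full cycle, the parity of the number of cycles of `π * ζ` is opposite to that
of `π`. -/
theorem neg_one_pow_cycleCount_mul {α : Type*} [Fintype α] [DecidableEq α]
    (π ζ : Equiv.Perm α) (hζ : cycleCount ζ = 1) :
    (-1 : ℤˣ) ^ cycleCount (π * ζ) = -Equiv.Perm.sign π := by
  have h := Equiv.Perm.sign_mul π ζ
  rw [sign_eq_neg_one_pow_card_add_cycleCount (π * ζ),
    sign_eq_neg_one_pow_card_add_cycleCount ζ, hζ, pow_add, pow_add] at h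
  apply mul_left_cancel (a := (-1 : ℤˣ) ^ Fintype.card α)
  rw [h]
  simp [mul_comm]

/-- `G_π(z) = z^{p(π)+1} · F_π(z²)`, where `p(π)` is the parity indicator of `π`. -/
theorem stmt_5 (n : ℕ) (hn : 1 ≤ n) (π : Equiv.Perm (Fin n)) :
    GPoly π =
      Polynomial.X ^ ((if Equiv.Perm.sign π = -1 then 1 else 0) + 1) *
        (IOPoly π).comp (Polynomial.X ^ 2) := by
  have : Nonempty (Fin n) := ⟨⟨0, hn⟩⟩
  simp only [GPoly, IOPoly, Polynomial.sum_comp, Polynomial.pow_comp, Polynomial.X_comp,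
    Finset.mul_sum, ← pow_mul, ← pow_add]
  refine Finset.sum_congr rfl fun ζ hζ => ?_
  have hpos := cycleCount_pos (π * ζ)
  have hsign := neg_one_pow_cycleCount_mul π ζ (Finset.mem_filter.1 hζ).2
  congr 1
  rcases Int.units_eq_one_or (Equiv.Perm.sign π) with h | h
  · have hodd : Odd (cycleCount (π * ζ)) := by
      by_contra hc
      rw [(Nat.not_odd_iff_even.1 hc).neg_one_pow, h] at hsign
      exact absurd hsign (by decide)
    obtain ⟨k, hk⟩ := hodd
    rw [h, if_neg (by decide)]
    omega
  · have heven : Even (cycleCount (π * ζ)) := by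
      by_contra hc
      rw [(Nat.not_even_iff_odd.1 hc).neg_one_pow, h] at hsign
      exact absurd hsign (by decide)
    obtain ⟨k, hk⟩ := heven
    rw [if_pos h]
    omega
end

section
/- Let n ≥ 1 and let 1 ≤ k ≤ n+1 be such that n − k is odd. Then C(n+2, 2) · #{ζ : ζ is an (n+1)-cycle in S_{n+1} and the permutation x ↦ ζ(ρ_{n+1}(x)) has exactly k cycles} = #{σ ∈ S_{n+2} : σ has exactly k cycles}, where C(n+2,2) = (n+2)(n+1)/2. Moreover, if n − k is even, then no (n+1)-cycle ζ satisfies c(ρ_{n+1}ζ) = k. -/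
open Finset Polynomial

namespace Equiv.Perm

section CycleCount

variable {α : Type*} [Fintype α] [DecidableEq α]

theorem cycleCount_add_card_support (σ : Perm α) :
    cycleCount σ + #σ.support = σ.cycleType.card + Fintype.card α := by
  have h : (univ.filter fun x => σ x = x) = σ.supportᶜ := by ext; simp
  have := card_add_card_compl σ.support
  rw [cycleCount, h]
  lia

theorem sign_eq_neg_one_pow_cycleCount (σ : Perm α) :
    sign σ = (-1) ^ (Fintype.card α + cycleCount σ) := by
  have h := cycleCount_add_card_support σ
  rw [sign_of_cycleType, sum_cycleType]
  apply Units.ext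
  push_cast
  have h2 : Fintype.card α + cycleCount σ + 2 * #σ.support
      = #σ.support + σ.cycleType.card + 2 * Fintype.card α := by lia
  have := congrArg (fun m => (-1 : ℤ) ^ m) h2
  simpa [pow_add, pow_mul] using this.symm

theorem cycleCount_eq_of_cycleType_eq {σ τ : Perm α} (h : σ.cycleType = τ.cycleType) :
    cycleCount σ = cycleCount τ := by
  have h1 := cycleCount_add_card_support σ
  have h2 := cycleCount_add_card_support τ
  rw [← sum_cycleType, h] at h1
  rw [← sum_cycleType] at h2
  lia

theorem cycleCount_conj (σ g : Perm α) : cycleCount (g * σ * g⁻¹) = cycleCount σ :=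
  cycleCount_eq_of_cycleType_eq cycleType_conj

theorem cycleCount_inv (σ : Perm α) : cycleCount σ⁻¹ = cycleCount σ :=
  cycleCount_eq_of_cycleType_eq (cycleType_inv σ)

theorem cycleCount_swap_mul {τ : Perm α} {p j : α} (hp : τ p = p) (hj : j ≠ p) :
    cycleCount (swap p j * τ) + 1 = cycleCount τ := by
  have hτ := cycleCount_add_card_support τ
  have hs := cycleCount_add_card_support (swap p j * τ)
  by_cases h : τ j = j
  · have hd : Disjoint (swap p j) τ := by
      intro x
      by_cases hx : x = p ∨ x = j
      · rcases hx with rfl | rfl <;> simp [hp, h]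
      · push Not at hx
        exact Or.inl (swap_apply_of_ne_of_ne hx.1 hx.2)
    rw [hd.card_support_mul, hd.cycleType_mul, card_support_swap hj.symm,
      (swap_isSwap_iff.mpr hj.symm).isCycle.cycleType] at hs
    simp only [Multiset.card_add, Multiset.card_singleton] at hs
    lia
  · set c := τ.cycleOf j with hc
    have hcmem : c ∈ τ.cycleFactorsFinset := by
      rw [hc, cycleOf_mem_cycleFactorsFinset_iff, mem_support]; exact h
    have hd : Disjoint (τ * c⁻¹) c := disjoint_mul_inv_of_mem_cycleFactorsFinset hcmem
    have hcy : c.IsCycle := isCycle_cycleOf τ h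
    have hjs : j ∈ τ.support := mem_support.2 h
    have hcj : c j ≠ j := by simpa [hc] using h
    have hcp : c p = p := by
      by_contra hcp
      have := support_cycleOf_le τ j (mem_support.2 hcp)
      exact (mem_support.1 this) hp
    obtain ⟨l, hl⟩ : ∃ l, τ.toList j = j :: l := by
      have h0 := toList_getElem_zero τ j hjs
      cases hL : τ.toList j with
      | nil => exact absurd hjs ((toList_eq_nil_iff).1 hL)
      | cons a l => simp only [hL, List.getElem_cons_zero] at h0; exact ⟨l, by rw [h0]⟩
    have hnd := nodup_toList τ j
    rw [hl] at hnd
    have hform : swap p j * c = (p :: j :: l).formPerm := by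
      rw [List.formPerm_cons_cons, ← hl, formPerm_toList]
    have hpl : p ∉ j :: l := by
      rw [← hl, mem_toList_iff]
      rintro ⟨h1, -⟩
      exact h ((h1.apply_eq_self_iff).2 hp)
    have hnd' : (p :: j :: l).Nodup := List.nodup_cons.2 ⟨hpl, hnd⟩
    have hcy' : (swap p j * c).IsCycle := by
      rw [hform]; exact List.isCycle_formPerm hnd' (by simp)
    have hcard : #(swap p j * c).support = #c.support + 1 := by
      rw [hform, List.support_formPerm_of_nodup _ hnd' (by simp), hc, ← length_toList, hl,
        List.toFinset_card_of_nodup hnd']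
      simp
    have hr : (τ * c⁻¹) p = p := by rw [mul_apply, inv_eq_iff_eq.2 hcp.symm, hp]
    have hd' : Disjoint (swap p j * c) (τ * c⁻¹) := by
      intro x
      rcases hd x with hx | hx
      · exact Or.inr hx
      · by_cases hxp : x = p
        · right; rw [hxp, hr]
        · left
          have hxj : x ≠ j := by rintro rfl; exact hcj hx
          rw [mul_apply, hx, swap_apply_of_ne_of_ne hxp hxj]
    have e1 : τ = c * (τ * c⁻¹) := by rw [← hd.commute.eq]; group
    have e2 : swap p j * τ = (swap p j * c) * (τ * c⁻¹) := by rw [mul_assoc, ← e1]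
    rw [e2, hd'.card_support_mul, hd'.cycleType_mul, hcy'.cycleType, hcard, ← e2] at hs
    have h3 := hd.symm.cycleType_mul
    have h4 := hd.symm.card_support_mul
    rw [← e1] at h3 h4
    rw [h3, h4, hcy.cycleType] at hτ
    simp only [Multiset.card_add, Multiset.card_singleton] at hs hτ
    lia

theorem card_add_one_le_cycleCount_add_card {ω : Perm α} {T : Finset α} (hT : T.Nonempty)
    (h : ∀ x ∉ T, ω x = x) : Fintype.card α + 1 ≤ cycleCount ω + #T := by
  have h1 := cycleCount_add_card_support ω
  have h2 : ω.support ⊆ T := fun x hx => by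
    by_contra hxT; exact mem_support.1 hx (h x hxT)
  have h3 := card_le_card h2
  have h4 := hT.card_pos
  rcases Nat.eq_zero_or_pos ω.cycleType.card with h0 | h0
  · rw [card_cycleType_eq_zero] at h0
    subst h0
    simp at h1
    lia
  · lia

end CycleCount

theorem apply_mem_of_fixed_compl {α : Type*} {S : Finset α} {σ : Perm α} (hσ : ∀ x ∉ S, σ x = x)
    {x : α} (hx : x ∈ S) : σ x ∈ S := by
  by_contra h
  exact h ((σ.injective (hσ _ h)).symm ▸ hx)

section DeletePoint

variable {α : Type*} [DecidableEq α]

/-- The permutation obtained from `σ` by deleting `p` from its cycle and fixing `p`. -/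
def deletePoint (p : α) (σ : Perm α) : Perm α := swap p (σ p) * σ

theorem deletePoint_apply_self (p : α) (σ : Perm α) : deletePoint p σ p = p := by
  simp [deletePoint]

theorem swap_mul_deletePoint (p : α) (σ : Perm α) : swap p (σ p) * deletePoint p σ = σ := by
  simp [deletePoint, ← mul_assoc]

theorem deletePoint_swap_mul {p j : α} {σ : Perm α} (hp : σ p = p) :
    deletePoint p (swap p j * σ) = σ := by
  simp [deletePoint, hp, ← mul_assoc]

theorem deletePoint_fixed_compl {S : Finset α} {σ : Perm α} (hσ : ∀ x ∉ S, σ x = x) (p : α) :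
    ∀ x ∉ S.erase p, deletePoint p σ x = x := by
  intro x hx
  by_cases hxp : x = p
  · rw [hxp, deletePoint_apply_self]
  have hxS : x ∉ S := fun h => hx (mem_erase.2 ⟨hxp, h⟩)
  have h1 : x ≠ σ p := fun h => hxp (σ.injective ((hσ x hxS).trans h))
  rw [deletePoint, mul_apply, hσ x hxS, swap_apply_of_ne_of_ne hxp h1]

theorem cycleCount_deletePoint [Fintype α] {p : α} {σ : Perm α} (h : σ p ≠ p) :
    cycleCount (deletePoint p σ) = cycleCount σ + 1 := by
  have := cycleCount_swap_mul (deletePoint_apply_self p σ) h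
  rw [swap_mul_deletePoint] at this
  exact this.symm

end DeletePoint

section Factorizations

variable {α : Type*} [Fintype α] [DecidableEq α]

/-- `ζ` fixes every point outside `S` and permutes `S` in a single cycle. -/
def IsFullOn (S : Finset α) (ζ : Perm α) : Prop :=
  (∀ x ∉ S, ζ x = x) ∧ cycleCount ζ + #S = Fintype.card α + 1

theorem isFullOn_iff_deletePoint {S : Finset α} {p : α} {ζ : Perm α} (hp : p ∈ S)
    (h : ζ p ≠ p) (hmem : ζ p ∈ S) : IsFullOn S ζ ↔ IsFullOn (S.erase p) (deletePoint p ζ) := by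
  have h1 := cycleCount_deletePoint h
  have h2 := card_erase_add_one hp
  refine and_congr ⟨fun hf => deletePoint_fixed_compl hf p, fun hf x hx => ?_⟩ (by lia)
  rw [← swap_mul_deletePoint p ζ, mul_apply, hf x (fun h => hx (mem_of_mem_erase h)),
    swap_apply_of_ne_of_ne (by rintro rfl; exact hx hp)
      (fun h => hx (by rw [h]; exact hmem))]

theorem IsFullOn.apply_ne {S : Finset α} {ζ : Perm α} (h : IsFullOn S ζ) (hS : 2 ≤ #S) {p : α}
    (hp : p ∈ S) : ζ p ≠ p := by
  intro hfix
  have hc := card_erase_add_one hp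
  have := card_add_one_le_cycleCount_add_card (ω := ζ) (T := S.erase p) (card_pos.1 (by lia)) (by
    intro x hx
    by_cases hxp : x = p
    · rw [hxp, hfix]
    · exact h.1 x fun hxS => hx (mem_erase.2 ⟨hxp, hxS⟩))
  have := h.2
  lia

theorem isFullOn_conj {S T : Finset α} {g : Perm α} (hg : ∀ x, g x ∈ T ↔ x ∈ S) (ζ : Perm α) :
    IsFullOn T (g * ζ * g⁻¹) ↔ IsFullOn S ζ := by
  have hcard : #S = #T := card_equiv g fun x => (hg x).symm
  rw [IsFullOn, IsFullOn, cycleCount_conj, hcard]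
  refine and_congr_left' ⟨fun h x hx => ?_, fun h x hx => ?_⟩
  · have := h (g x) (fun h => hx ((hg x).1 h))
    simpa using this
  · have := h (g⁻¹ x) (fun h => hx (by simpa using (hg _).2 h))
    rw [mul_apply, mul_apply, this, ← mul_apply, mul_inv_cancel, one_apply]

open Classical in
/-- The number of `ζ` such that both `ζ` and `τ * ζ` permute `S` in a single cycle. -/
noncomputable def fullPairCount (S : Finset α) (τ : Perm α) : ℕ :=
  #{ζ : Perm α | IsFullOn S ζ ∧ IsFullOn S (τ * ζ)}

theorem fullPairCount_conj {S T : Finset α} {g : Perm α} (hg : ∀ x, g x ∈ T ↔ x ∈ S)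
    (τ : Perm α) : fullPairCount T (g * τ * g⁻¹) = fullPairCount S τ := by
  classical
  refine (card_equiv (MulAut.conj g).toEquiv fun ζ => ?_).symm
  have : g * τ * g⁻¹ * (g * ζ * g⁻¹) = g * (τ * ζ) * g⁻¹ := by group
  simp [isFullOn_conj hg, this]

theorem fullPairCount_inv (S : Finset α) (τ : Perm α) :
    fullPairCount S τ⁻¹ = fullPairCount S τ := by
  classical
  refine (card_equiv (Equiv.mulLeft τ) fun ζ => ?_).symm
  simp [and_comm]

theorem fullPairCount_eq_sum {S : Finset α} {τ : Perm α} (hτ : ∀ x ∉ S, τ x = x) (hS : 2 ≤ #S)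
    {s : α} (hs : s ∈ S) :
    fullPairCount S τ = ∑ j ∈ S.erase s, if τ j = s then 0 else
      fullPairCount (S.erase s) (swap s (τ j) * τ * swap s j) := by
  classical
  rw [fullPairCount, card_eq_sum_card_fiberwise (f := fun ζ => ζ s) (t := S.erase s)]
  · refine sum_congr rfl fun j hj => ?_
    obtain ⟨hjs, hjS⟩ := mem_erase.1 hj
    split_ifs with h
    · refine card_eq_zero.2 (filter_eq_empty_iff.2 fun ζ hζ hζs => ?_)
      refine (mem_filter.1 hζ).2.2.apply_ne hS hs ?_
      rw [mul_apply, hζs, h]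
    · have key : ∀ ζ : Perm α, ζ s = j → ((IsFullOn S ζ ∧ IsFullOn S (τ * ζ)) ↔
          (IsFullOn (S.erase s) (deletePoint s ζ) ∧ IsFullOn (S.erase s)
            (swap s (τ j) * τ * swap s j * deletePoint s ζ))) := by
        intro ζ hζ
        have e : swap s (τ j) * τ * swap s j * deletePoint s ζ = deletePoint s (τ * ζ) := by
          rw [← hζ, mul_assoc, swap_mul_deletePoint, deletePoint, mul_apply, mul_assoc]
        rw [e, isFullOn_iff_deletePoint hs (by rw [hζ]; exact hjs) (by rw [hζ]; exact hjS),
          isFullOn_iff_deletePoint hs (by rw [mul_apply, hζ]; exact h)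
            (by rw [mul_apply, hζ]; exact apply_mem_of_fixed_compl hτ hjS)]
      refine card_nbij' (deletePoint s) (fun ζ => swap s j * ζ) ?_ ?_ ?_ ?_
      · intro ζ hζ
        simp only [coe_filter, mem_filter, mem_univ, true_and, Set.mem_ofPred_eq] at hζ ⊢
        exact (key ζ hζ.2).1 hζ.1
      · intro ζ hζ
        simp only [coe_filter, mem_filter, mem_univ, true_and, Set.mem_ofPred_eq] at hζ ⊢
        have hfix : ζ s = s := hζ.1.1 s (notMem_erase s S)
        have hval : (swap s j * ζ) s = j := by simp [hfix]
        refine ⟨(key _ hval).2 ?_, hval⟩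
        rwa [deletePoint_swap_mul hfix]
      · intro ζ hζ
        simp only [coe_filter, mem_filter, mem_univ, true_and, Set.mem_ofPred_eq] at hζ
        rw [← hζ.2]
        exact swap_mul_deletePoint s ζ
      · intro ζ hζ
        simp only [coe_filter, mem_univ, true_and, Set.mem_ofPred_eq] at hζ
        exact deletePoint_swap_mul (hζ.1.1 s (notMem_erase s S))
  · intro ζ hζ
    simp only [coe_filter, mem_univ, true_and, Set.mem_ofPred_eq] at hζ
    exact mem_erase.2 ⟨hζ.1.apply_ne hS hs, apply_mem_of_fixed_compl hζ.1.1 hs⟩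

theorem fullPairCount_singleton {x : α} {τ : Perm α} (hτ : ∀ y ∉ ({x} : Finset α), τ y = y) :
    fullPairCount {x} τ = 1 := by
  classical
  have eq_one : ∀ ω : Perm α, (∀ y ∉ ({x} : Finset α), ω y = y) → ω = 1 := by
    intro ω hω
    ext y
    by_cases hy : y ∈ ({x} : Finset α)
    · have := apply_mem_of_fixed_compl hω hy
      rw [mem_singleton] at hy this
      rw [this, hy, one_apply]
    · exact hω y hy
  rw [eq_one τ hτ, fullPairCount, card_eq_one]
  refine ⟨1, Finset.ext fun ζ => ?_⟩
  have h1 := cycleCount_add_card_support (1 : Perm α)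
  simp only [mem_filter, mem_univ, true_and, mem_singleton, one_mul, and_self]
  refine ⟨fun h => eq_one ζ h.1, ?_⟩
  rintro rfl
  refine ⟨fun y _ => rfl, ?_⟩
  simpa using h1

/-- An odd permutation has exactly `2 * (#S - 2)!` factorizations into a full cycle on `S` and
a cycle missing exactly one point of `S`; here they are counted according to the missed point. -/
theorem sum_fullPairCount_deletePoint {S : Finset α} {σ : Perm α} (hσ : ∀ x ∉ S, σ x = x)
    (hsign : sign σ = -1) :
    (∑ p ∈ S, if σ p = p then 0 else fullPairCount (S.erase p) (deletePoint p σ)) =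
      2 * (#S - 2).factorial := by
  induction hm : #S generalizing S σ with
  | zero =>
    rw [card_eq_zero] at hm
    have : σ = 1 := by ext x; exact hσ x (by simp [hm])
    simp [this] at hsign
  | succ m ih =>
    obtain ⟨s, hs⟩ : ∃ s, σ s ≠ s := by
      by_contra! h
      have : σ = 1 := by ext x; exact h x
      simp [this] at hsign
    have hsS : s ∈ S := by by_contra h; exact hs (hσ s h)
    obtain ⟨l, hl⟩ : ∃ l, σ l = s := σ.surjective s
    have hls : l ≠ s := by rintro rfl; exact hs hl
    have hlS : l ∈ S := by
      by_contra h; exact hls ((hσ l h).symm.trans hl)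
    set T := S.erase s with hT
    have hTm : #T = m := by rw [hT, card_erase_of_mem hsS, hm]; rfl
    have hlT : l ∈ T := mem_erase.2 ⟨hls, hlS⟩
    have hsT : s ∉ T := notMem_erase s S
    set υ := deletePoint s σ with hυ
    have hυT : ∀ x ∉ T, υ x = x := deletePoint_fixed_compl hσ s
    have hυ' : υ = σ * swap s l := by
      rw [hυ, deletePoint, mul_swap_eq_swap_mul, hl, swap_comm]
    have hterm_s : (if σ s = s then 0 else fullPairCount (S.erase s) (deletePoint s σ)) =
        fullPairCount T υ := if_neg hs
    have hterm_l : (if σ l = l then 0 else fullPairCount (S.erase l) (deletePoint l σ)) =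
        fullPairCount T υ := by
      rw [if_neg (by rw [hl]; exact hls.symm)]
      have hconj : deletePoint l σ = swap s l * υ * (swap s l)⁻¹ := by
        rw [hυ', swap_inv, mul_assoc, mul_assoc, swap_mul_self, mul_one, deletePoint, hl, swap_comm]
      rw [hconj]
      refine fullPairCount_conj (fun x => ?_) υ
      rcases eq_or_ne x s with rfl | hxs
      · simp [hT]
      · rcases eq_or_ne x l with rfl | hxl
        · simp [hT, hls, hls.symm, hsS, hlS]
        · rw [swap_apply_of_ne_of_ne hxs hxl]; simp [hT, hxs, hxl]
    rw [← add_sum_erase S _ hsS, ← hT, ← add_sum_erase T _ hlT, hterm_s, hterm_l]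
    rcases Nat.lt_or_ge m 2 with hm2 | hm2
    · have hm1 : #T = 1 := by have := card_pos.2 ⟨l, hlT⟩; lia
      have hTl : T = {l} := by
        obtain ⟨a, ha⟩ := card_eq_one.1 hm1
        rw [ha, mem_singleton] at hlT
        rw [ha, hlT]
      rw [hTl, fullPairCount_singleton (by rw [← hTl]; exact hυT)]
      have : m = 1 := by lia
      simp [this]
    · set κ : α → Perm α := fun j => υ * swap j l with hκ
      set X : α → α → ℕ := fun j p =>
        if κ j p = p then 0 else fullPairCount (T.erase p) (deletePoint p (κ j)) with hX
      have hXsum : ∀ j ∈ T.erase l, ∑ p ∈ T, X j p = 2 * (m - 2).factorial := by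
        intro j hj
        obtain ⟨hjl, hjT⟩ := mem_erase.1 hj
        refine ih (fun x hx => ?_) ?_ hTm
        · rw [hκ, mul_apply, swap_apply_of_ne_of_ne (by rintro rfl; exact hx hjT)
            (by rintro rfl; exact hx hlT), hυT x hx]
        · rw [hκ, hυ', sign_mul, sign_mul, sign_swap hls.symm, sign_swap hjl, hsign]
          decide
      have hXl : ∑ j ∈ T.erase l, X j l = fullPairCount T υ := by
        rw [fullPairCount_eq_sum hυT (by lia) hlT]
        refine sum_congr rfl fun j _ => ?_
        have h1 : κ j l = υ j := by simp [hκ]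
        simp only [hX, h1]
        rw [deletePoint, h1, hκ, ← mul_assoc, swap_comm j l]
      have hXj : ∑ j ∈ T.erase l, X j j = fullPairCount T υ := by
        have hinvT : ∀ x ∉ T, υ⁻¹ x = x := fun x hx => by
          rw [inv_eq_iff_eq, hυT x hx]
        rw [← fullPairCount_inv T υ, fullPairCount_eq_sum hinvT (by lia) hlT]
        refine sum_congr rfl fun j hj => ?_
        obtain ⟨hjl, hjT⟩ := mem_erase.1 hj
        have h1 : κ j j = υ l := by simp [hκ]
        have h2 : υ l = j ↔ υ⁻¹ j = l := by rw [inv_eq_iff_eq, eq_comm]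
        simp only [hX, h1, h2]
        split_ifs with h
        · rfl
        rw [← fullPairCount_inv (T.erase l)]
        have h3 : deletePoint j (κ j) = swap j l *
            (swap l (υ⁻¹ j) * υ⁻¹ * swap l j)⁻¹ * (swap j l)⁻¹ := by
          have h4 : υ * swap l (υ⁻¹ j) = swap (υ l) j * υ := by
            rw [mul_swap_eq_swap_mul, ← mul_apply, mul_inv_cancel, one_apply]
          rw [mul_inv_rev, mul_inv_rev, swap_inv, swap_inv, swap_inv, inv_inv, h4, deletePoint, h1,
            hκ, swap_comm l j, ← mul_assoc (swap j l), swap_mul_self, one_mul, swap_comm j (υ l),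
            mul_assoc]
        rw [h3]
        refine fullPairCount_conj (fun x => ?_) _
        rcases eq_or_ne x j with rfl | hxj
        · simp [hjl, hjl.symm, hjT, hlT]
        · rcases eq_or_ne x l with rfl | hxl
          · simp
          · rw [swap_apply_of_ne_of_ne hxj hxl]; simp [hxj, hxl]
      have hrow : ∀ p ∈ T.erase l,
          (if σ p = p then 0 else fullPairCount (S.erase p) (deletePoint p σ)) =
            ∑ j ∈ T.erase l, if p = j then 0 else X j p := by
        intro p hp
        obtain ⟨hpl, hpT⟩ := mem_erase.1 hp
        obtain ⟨hps, hpS⟩ := mem_erase.1 hpT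
        have hκp : ∀ j, p ≠ j → κ j p = σ p := fun j hpj => by
          rw [hκ, hυ', mul_apply, mul_apply, swap_apply_of_ne_of_ne hpj hpl,
            swap_apply_of_ne_of_ne hps hpl]
        by_cases hfix : σ p = p
        · rw [if_pos hfix]
          refine (sum_eq_zero fun j _ => ?_).symm
          split_ifs with hpj
          · rfl
          · simp only [hX]; rw [hκp j hpj, if_pos hfix]
        · rw [if_neg hfix]
          set τ := deletePoint p σ with hτ
          have hτl : τ l = s := by
            rw [hτ, deletePoint, mul_apply, hl]
            refine swap_apply_of_ne_of_ne hps.symm fun h => hpl ?_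
            exact σ.injective (h.symm.trans hl.symm)
          have hTp : (S.erase p).erase s = T.erase p := by rw [hT, erase_right_comm]
          rw [fullPairCount_eq_sum (deletePoint_fixed_compl hσ p)
            (by rw [card_erase_of_mem hpS]; lia) (mem_erase.2 ⟨hps.symm, hsS⟩), hTp,
            ← sum_erase (T.erase p) (a := l) (by simp [← hτ, hτl]),
            ← sum_erase (T.erase l) (a := p) (by simp), erase_right_comm]
          refine sum_congr rfl fun j hj => ?_
          obtain ⟨hjp, hj⟩ := mem_erase.1 hj
          obtain ⟨hjl, hjT⟩ := mem_erase.1 hj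
          rw [← hτ, if_neg (fun h => hjl (τ.injective (h.trans hτl.symm))), if_neg hjp.symm]
          simp only [hX]
          rw [hκp j hjp.symm, if_neg hfix]
          congr 1
          have hjs : j ≠ s := by rintro rfl; exact hsT hjT
          have h5 : swap s (τ j) * τ = τ * swap l j := by rw [mul_swap_eq_swap_mul, hτl]
          have h6 : swap l j * swap s j = swap s l * swap j l := by
            rw [mul_swap_eq_swap_mul, swap_apply_right,
              swap_apply_of_ne_of_ne hls.symm hjs.symm, swap_comm l j]
          rw [h5, mul_assoc, h6, deletePoint, hκp j hjp.symm, hκ, hυ', hτ, deletePoint]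
          simp only [mul_assoc]
      rw [sum_congr rfl hrow, sum_comm]
      have hsplit : ∀ j ∈ T.erase l, X j l + (X j j + ∑ p ∈ T.erase l, if p = j then 0 else X j p) =
          2 * (m - 2).factorial := by
        intro j hj
        rw [← hXsum j hj, ← add_sum_erase T _ hlT, ← add_sum_erase (T.erase l) (X j) hj,
          ← sum_erase (T.erase l) (a := j) (f := fun p => if p = j then 0 else X j p) (by simp)]
        congr 2
        exact sum_congr rfl fun p hp => if_neg (ne_of_mem_erase hp)
      have htot := sum_congr rfl hsplit
      rw [sum_add_distrib, sum_add_distrib, hXl, hXj, sum_const, card_erase_of_mem hlT, hTm,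
        smul_eq_mul] at htot
      have hfac : (m + 1 - 2).factorial = (m - 1) * (m - 2).factorial := by
        obtain ⟨r, rfl⟩ := Nat.exists_eq_add_of_le hm2
        rw [show 2 + r + 1 - 2 = r + 1 by lia, show 2 + r - 1 = r + 1 by lia,
          show 2 + r - 2 = r by lia, Nat.factorial_succ]
      rw [hfac, ← add_assoc, ← mul_assoc, mul_comm 2, mul_assoc, ← htot]
      ring

end Factorizations

theorem extendDomain_apply_self {α β : Type*} [DecidableEq α] {p : α} (e : β ≃ {x // x ≠ p})
    (τ : Perm β) : τ.extendDomain e p = p :=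
  extendDomain_apply_not_subtype τ e (by simp)

theorem exists_extendDomain_eq {α β : Type*} [DecidableEq α] {p : α} (e : β ≃ {x // x ≠ p})
    {σ : Perm α} (hσ : σ p = p) :
    ∃ τ : Perm β, τ.extendDomain e = σ := by
  have hmem : ∀ x, σ x ≠ p ↔ x ≠ p := fun x => by
    rw [Ne, Ne, ← σ.apply_eq_iff_eq (x := x) (y := p), hσ]
  refine ⟨e.permCongr.symm (σ.subtypePerm hmem), ?_⟩
  ext x
  by_cases hx : x = p
  · rw [hx, extendDomain_apply_self, hσ]
  · rw [extendDomain_apply_subtype (p := fun x => x ≠ p) _ _ hx]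
    simp

section Counting

variable {α β : Type*} [Fintype α] [DecidableEq α] [Fintype β] [DecidableEq β]

theorem isFullOn_univ_iff {ζ : Perm α} : IsFullOn univ ζ ↔ cycleCount ζ = 1 := by
  simp only [IsFullOn, mem_univ, not_true_eq_false, false_imp_iff, implies_true, true_and,
    card_univ]
  lia

theorem cycleCount_eq_one_iff (h : 2 ≤ Fintype.card α) {ζ : Perm α} :
    cycleCount ζ = 1 ↔ ζ.cycleType = {Fintype.card α} := by
  have h1 := cycleCount_add_card_support ζ
  have h2 := card_le_univ ζ.support
  rw [← sum_cycleType] at h1 h2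
  constructor
  · intro hc
    have h3 : ζ.cycleType.card ≠ 0 := by
      intro h0
      obtain rfl := card_cycleType_eq_zero.1 h0
      simp only [cycleType_one, Multiset.sum_zero, Multiset.card_zero] at h1
      lia
    obtain ⟨a, ha⟩ := Multiset.card_eq_one.1 (show ζ.cycleType.card = 1 by lia)
    rw [ha] at h1 ⊢
    simp only [Multiset.sum_singleton, Multiset.card_singleton] at h1
    rw [show a = Fintype.card α by lia]
  · intro hc
    rw [hc] at h1
    simp only [Multiset.sum_singleton, Multiset.card_singleton] at h1
    lia

theorem card_cycleCount_eq_one (h : 2 ≤ Fintype.card α) :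
    #{ζ : Perm α | cycleCount ζ = 1} = (Fintype.card α - 1).factorial := by
  simp_rw [cycleCount_eq_one_iff h]
  rw [card_of_cycleType_singleton h le_rfl, Nat.choose_self, mul_one]

theorem sum_fullPairCount_univ (h : 2 ≤ Fintype.card α) {ρ : Perm α} (hρ : cycleCount ρ = 1)
    (k : ℕ) :
    ∑ τ : Perm α with cycleCount τ = k, fullPairCount univ τ =
      (Fintype.card α - 1).factorial *
        #{ζ : Perm α | cycleCount ζ = 1 ∧ cycleCount (ζ * ρ) = k} := by
  classical
  rw [← card_cycleCount_eq_one h, ← smul_eq_mul, ← sum_const]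
  simp only [fullPairCount, isFullOn_univ_iff, ← filter_filter]
  refine (sum_card_bipartiteAbove_eq_sum_card_bipartiteBelow
    fun τ ζ : Perm α => cycleCount (τ * ζ) = 1).trans ?_
  refine sum_congr rfl fun ζ hζ => ?_
  rw [mem_filter_univ, ← cycleCount_inv] at hζ
  rw [cycleCount_eq_one_iff h] at hρ hζ
  obtain ⟨g, hg⟩ := isConj_iff.1 (isConj_iff_cycleType_eq.2 (hζ.trans hρ.symm))
  refine card_equiv ((Equiv.mulRight ζ).trans (MulAut.conj g).toEquiv) fun τ => ?_
  have h1 : g * (τ * ζ) * g⁻¹ * ρ = g * τ * g⁻¹ := by rw [← hg]; group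
  simp [bipartiteBelow, h1, cycleCount_conj, and_comm]

theorem cycleCount_extendDomain {p : α} (e : β ≃ {x // x ≠ p}) (τ : Perm β) :
    cycleCount (τ.extendDomain e) = cycleCount τ + 1 := by
  have h1 := cycleCount_add_card_support τ
  have h2 := cycleCount_add_card_support (τ.extendDomain e)
  have h3 := Fintype.card_congr e
  have h4 : Fintype.card {x // x ≠ p} = Fintype.card α - 1 := by
    rw [Fintype.card_subtype_compl, Fintype.card_subtype_eq]
  have h5 : 0 < Fintype.card α := Fintype.card_pos_iff.2 ⟨p⟩
  rw [← sum_cycleType, cycleType_extendDomain] at h2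
  rw [← sum_cycleType] at h1
  lia

theorem isFullOn_extendDomain_iff {p : α} (e : β ≃ {x // x ≠ p}) (ζ : Perm β) :
    IsFullOn (univ.erase p) (ζ.extendDomain e) ↔ cycleCount ζ = 1 := by
  have h1 := cycleCount_extendDomain e ζ
  have h2 := card_erase_add_one (mem_univ p)
  rw [card_univ] at h2
  rw [IsFullOn, and_iff_right]
  · lia
  · intro x hx
    obtain rfl : x = p := by simpa using hx
    exact extendDomain_apply_self e ζ

theorem fullPairCount_extendDomain {p : α} (e : β ≃ {x // x ≠ p}) (τ : Perm β) :
    fullPairCount (univ.erase p) (τ.extendDomain e) = fullPairCount univ τ := by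
  classical
  symm
  refine card_bij (fun ζ _ => ζ.extendDomain e) (fun ζ hζ => ?_)
    (fun ζ _ ξ _ h => extendDomainHom_injective e h) (fun ξ hξ => ?_)
  · rw [mem_filter_univ] at hζ ⊢
    rw [extendDomain_mul, isFullOn_extendDomain_iff, isFullOn_extendDomain_iff]
    simpa only [isFullOn_univ_iff] using hζ
  · rw [mem_filter_univ] at hξ
    obtain ⟨ζ, rfl⟩ := exists_extendDomain_eq e (hξ.1.1 p (notMem_erase p univ))
    refine ⟨ζ, ?_, rfl⟩
    rw [extendDomain_mul, isFullOn_extendDomain_iff, isFullOn_extendDomain_iff] at hξ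
    simpa only [mem_filter_univ, isFullOn_univ_iff] using hξ

theorem sum_fullPairCount_erase {p : α} (e : β ≃ {x // x ≠ p}) (k : ℕ) :
    ∑ τ : Perm α with τ p = p ∧ cycleCount τ = k + 1, fullPairCount (univ.erase p) τ =
      ∑ τ : Perm β with cycleCount τ = k, fullPairCount univ τ := by
  symm
  refine sum_bij (fun τ _ => τ.extendDomain e) (fun τ hτ => ?_)
    (fun τ _ ξ _ h => extendDomainHom_injective e h) (fun ξ hξ => ?_)
    (fun τ _ => (fullPairCount_extendDomain e τ).symm)
  · rw [mem_filter_univ] at hτ ⊢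
    exact ⟨extendDomain_apply_self e τ, by rw [cycleCount_extendDomain, hτ]⟩
  · rw [mem_filter_univ] at hξ
    obtain ⟨τ, rfl⟩ := exists_extendDomain_eq e hξ.1
    refine ⟨τ, ?_, rfl⟩
    rw [cycleCount_extendDomain] at hξ
    rw [mem_filter_univ]
    exact Nat.succ_injective hξ.2

theorem sum_fullPairCount_deletePoint_erase (p : α) (k : ℕ) :
    (∑ σ : Perm α with cycleCount σ = k,
      if σ p = p then 0 else fullPairCount (univ.erase p) (deletePoint p σ)) =
      (Fintype.card α - 1) * ∑ τ : Perm α with τ p = p ∧ cycleCount τ = k + 1,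
        fullPairCount (univ.erase p) τ := by
  have hcard : Fintype.card α - 1 = #(univ.erase p) := by
    rw [card_erase_of_mem (mem_univ p), card_univ]
  simp_rw [hcard, ← ite_not (_ = p)]
  rw [← smul_eq_mul, ← sum_const, ← sum_product', ← sum_filter, filter_filter]
  refine sum_nbij' (fun σ => (σ p, deletePoint p σ)) (fun x => swap p x.1 * x.2) ?_ ?_ ?_ ?_ ?_
  · intro σ hσ
    rw [mem_filter_univ] at hσ
    simp only [mem_product, mem_erase, mem_univ, and_true, mem_filter_univ]
    exact ⟨hσ.2, deletePoint_apply_self p σ, by rw [cycleCount_deletePoint hσ.2, hσ.1]⟩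
  · rintro ⟨j, τ⟩ h
    simp only [mem_product, mem_erase, mem_univ, and_true, mem_filter_univ] at h ⊢
    have := cycleCount_swap_mul h.2.1 h.1
    exact ⟨by lia, by simpa [h.2.1] using h.1⟩
  · intro σ _
    exact swap_mul_deletePoint p σ
  · rintro ⟨j, τ⟩ h
    simp only [mem_product, mem_erase, mem_univ, and_true, mem_filter_univ] at h
    simp [deletePoint_swap_mul h.2.1, h.2.1]
  · intro σ _
    rfl

/-- The number of full cycles `ζ` with `cycleCount (ζ * ρ) = k`, for `ρ` a full cycle on a set
with one point less than `α`, in terms of the number of odd permutations of `α` with `k` cycles. -/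
theorem choose_two_mul_card_eq (hβ : 2 ≤ Fintype.card β)
    (hαβ : Fintype.card α = Fintype.card β + 1) {ρ : Perm β} (hρ : cycleCount ρ = 1) {k : ℕ}
    (hk : Odd (Fintype.card α + k)) :
    (Fintype.card α).choose 2 * #{ζ : Perm β | cycleCount ζ = 1 ∧ cycleCount (ζ * ρ) = k} =
      #{σ : Perm α | cycleCount σ = k} := by
  set A := #{ζ : Perm β | cycleCount ζ = 1 ∧ cycleCount (ζ * ρ) = k} with hA
  have h1 : ∑ σ : Perm α with cycleCount σ = k, ∑ p : α,
      (if σ p = p then 0 else fullPairCount (univ.erase p) (deletePoint p σ)) =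
      #{σ : Perm α | cycleCount σ = k} * (2 * (Fintype.card β - 1).factorial) := by
    rw [← smul_eq_mul, ← sum_const]
    refine sum_congr rfl fun σ hσ => ?_
    rw [mem_filter_univ] at hσ
    have hsign : sign σ = -1 := by
      rw [sign_eq_neg_one_pow_cycleCount, hσ, hk.neg_one_pow]
    rw [sum_fullPairCount_deletePoint (fun x hx => absurd (mem_univ x) hx) hsign, card_univ, hαβ]
    rfl
  have h2 : ∀ p : α, (∑ σ : Perm α with cycleCount σ = k,
      if σ p = p then 0 else fullPairCount (univ.erase p) (deletePoint p σ)) =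
      Fintype.card β * ((Fintype.card β - 1).factorial * A) := by
    intro p
    have hcard : Fintype.card β = Fintype.card {x // x ≠ p} := by
      rw [Fintype.card_subtype_compl, Fintype.card_subtype_eq, hαβ, Nat.add_sub_cancel]
    rw [sum_fullPairCount_deletePoint_erase, sum_fullPairCount_erase (Fintype.equivOfCardEq hcard),
      sum_fullPairCount_univ hβ hρ, hαβ, Nat.add_sub_cancel]
  rw [sum_comm, sum_congr rfl fun p _ => h2 p, sum_const, card_univ, smul_eq_mul] at h1
  have hchoose : (Fintype.card α).choose 2 * 2 = Fintype.card α * Fintype.card β := by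
    rw [Nat.choose_two_right, Nat.div_mul_cancel (Nat.even_mul_pred_self _).two_dvd, hαβ,
      Nat.add_sub_cancel]
  have hpos : 0 < 2 * (Fintype.card β - 1).factorial :=
    Nat.mul_pos two_pos (Nat.factorial_pos _)
  refine Nat.eq_of_mul_eq_mul_right hpos ?_
  rw [← h1, ← mul_assoc, mul_right_comm _ A, hchoose]
  ring

theorem even_card_add_cycleCount_mul {ζ ρ : Perm α} (hζ : cycleCount ζ = 1)
    (hρ : cycleCount ρ = 1) : Even (Fintype.card α + cycleCount (ζ * ρ)) := by
  have h := sign_mul ζ ρ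
  rw [sign_eq_neg_one_pow_cycleCount ζ, sign_eq_neg_one_pow_cycleCount ρ, hζ, hρ, ← mul_pow,
    neg_mul_neg, one_mul, one_pow, sign_eq_neg_one_pow_cycleCount] at h
  by_contra hodd
  rw [(Nat.not_even_iff_odd.1 hodd).neg_one_pow] at h
  exact absurd h (by decide)

end Counting

end Equiv.Perm

/-- For `1 ≤ k ≤ n+1` with `n - k` odd, `C(n+2,2)` times the number of `(n+1)`-cycles
`ζ` with `c(x ↦ ζ(ρ_{n+1}(x))) = k` equals the number of permutations of `{1,…,n+2}`
with exactly `k` cycles (a signless Stirling number of the first kind); and if `n - k`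
is even there is no such `(n+1)`-cycle. -/
theorem stmt_7 (n k : ℕ) (hn : 1 ≤ n) (hk1 : 1 ≤ k) (hk2 : k ≤ n + 1) :
    (Odd ((n : ℤ) - k) →
      (n + 2).choose 2 *
        (Finset.univ.filter (fun ζ : Equiv.Perm (Fin (n + 1)) =>
          cycleCount ζ = 1 ∧ cycleCount (ζ * finRotate (n + 1)) = k)).card =
      (Finset.univ.filter (fun σ : Equiv.Perm (Fin (n + 2)) => cycleCount σ = k)).card) ∧
    (Even ((n : ℤ) - k) →
      ∀ ζ : Equiv.Perm (Fin (n + 1)), cycleCount ζ = 1 →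
        cycleCount (ζ * finRotate (n + 1)) ≠ k) := by
  have hcard : 2 ≤ Fintype.card (Fin (n + 1)) := by rw [Fintype.card_fin]; lia
  have hρ : cycleCount (finRotate (n + 1)) = 1 := by
    rw [Equiv.Perm.cycleCount_eq_one_iff hcard, cycleType_finRotate_of_le (by lia),
      Fintype.card_fin]
  refine ⟨fun hodd => ?_, fun heven ζ hζ hk => ?_⟩
  · have h := Equiv.Perm.choose_two_mul_card_eq (α := Fin (n + 2)) (k := k) hcard (by simp) hρ (by
      rw [Fintype.card_fin]
      obtain ⟨r, hr⟩ := hodd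
      exact ⟨(r + 1 + k).toNat, by lia⟩)
    rwa [Fintype.card_fin] at h
  · have h := Equiv.Perm.even_card_add_cycleCount_mul hζ hρ
    rw [hk, Fintype.card_fin] at h
    obtain ⟨r, hr⟩ := heven
    obtain ⟨t, ht⟩ := h
    lia
end
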